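/- For every polynomial u ∈ F_11[X] whose constant coefficient is nonzero, the number of indices t with 0 ≤ t ≤ 5 for which the coefficient of X^t in u·g1 is nonzero, plus the number of indices t with 0 ≤ t ≤ 5 for which the coefficient of X^t in u·g2 is nonzero, is at least 6. (Equivalently, the truncation of the codeword v(D) = u(D)·G(D) to the time window [0,5] has Hamming weight at least 6.) -/

import Mathlib

open Polynomial

/-- The number of nonzero entries of the pair `(x, y)`. -/
def pairWeight (x y : ZMod 11) : ℕ :=
  (if x ≠ 0 then 1 else 0) + (if y ≠ 0 then 1 else 0)

/-- The finite search behind the bound: each implication cuts off the branches whose partial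
weight has already reached `6`. -/
theorem six_le_sum_pairWeight_of_partial_lt :
    ∀ a : ZMod 11, a ≠ 0 → ∀ b : ZMod 11,
      pairWeight (8 * a) (8 * a) +
        pairWeight (5 * a + 8 * b) (6 * a + 8 * b) < 6 →
      ∀ c : ZMod 11,
      pairWeight (8 * a) (8 * a) +
        pairWeight (5 * a + 8 * b) (6 * a + 8 * b) +
        pairWeight (a + 5 * b + 8 * c) (a + 6 * b + 8 * c) < 6 →
      ∀ d : ZMod 11,
      pairWeight (8 * a) (8 * a) +
        pairWeight (5 * a + 8 * b) (6 * a + 8 * b) +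
        pairWeight (a + 5 * b + 8 * c) (a + 6 * b + 8 * c) +
        pairWeight (a + b + 5 * c + 8 * d) (a + b + 6 * c + 8 * d) < 6 →
      ∀ e : ZMod 11,
      pairWeight (8 * a) (8 * a) +
        pairWeight (5 * a + 8 * b) (6 * a + 8 * b) +
        pairWeight (a + 5 * b + 8 * c) (a + 6 * b + 8 * c) +
        pairWeight (a + b + 5 * c + 8 * d) (a + b + 6 * c + 8 * d) +
        pairWeight (5 * a + b + c + 5 * d + 8 * e) (6 * a + b + c + 6 * d + 8 * e) < 6 →
      ∀ f : ZMod 11,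
      6 ≤ pairWeight (8 * a) (8 * a) +
        pairWeight (5 * a + 8 * b) (6 * a + 8 * b) +
        pairWeight (a + 5 * b + 8 * c) (a + 6 * b + 8 * c) +
        pairWeight (a + b + 5 * c + 8 * d) (a + b + 6 * c + 8 * d) +
        pairWeight (5 * a + b + c + 5 * d + 8 * e) (6 * a + b + c + 6 * d + 8 * e) +
        pairWeight (8 * a + 5 * b + c + d + 5 * e + 8 * f) (8 * a + 6 * b + c + d + 6 * e + 8 * f) := by
  decide +kernel

/-- The coefficients up to degree `5` of the product of `u` with a palindromic quintic. -/
theorem coeff_mul_palindromic_quintic (u : (ZMod 11)[X]) (r s : ZMod 11) :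
    let g := C r + C s * X + X ^ 2 + X ^ 3 + C s * X ^ 4 + C r * X ^ 5
    (u * g).coeff 0 = r * u.coeff 0 ∧
    (u * g).coeff 1 = s * u.coeff 0 + r * u.coeff 1 ∧
    (u * g).coeff 2 = u.coeff 0 + s * u.coeff 1 + r * u.coeff 2 ∧
    (u * g).coeff 3 = u.coeff 0 + u.coeff 1 + s * u.coeff 2 + r * u.coeff 3 ∧
    (u * g).coeff 4 =
      s * u.coeff 0 + u.coeff 1 + u.coeff 2 + s * u.coeff 3 + r * u.coeff 4 ∧
    (u * g).coeff 5 =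
      r * u.coeff 0 + s * u.coeff 1 + u.coeff 2 + u.coeff 3 + s * u.coeff 4 + r * u.coeff 5 := by
  intro g
  refine ⟨?_, ?_, ?_, ?_, ?_, ?_⟩ <;>
  · simp [g, coeff_mul, Finset.Nat.antidiagonal_succ, coeff_X, coeff_C, coeff_X_pow]
    try ring

theorem stmt13
    (g1 g2 : Polynomial (ZMod 11))
    (hg1 : g1 = C 8 + C 5 * X + X ^ 2 + X ^ 3 + C 5 * X ^ 4 + C 8 * X ^ 5)
    (hg2 : g2 = C 8 + C 6 * X + X ^ 2 + X ^ 3 + C 6 * X ^ 4 + C 8 * X ^ 5) :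
    ∀ u : Polynomial (ZMod 11), u.coeff 0 ≠ 0 →
      6 ≤ ((Finset.range 6).filter (fun t => (u * g1).coeff t ≠ 0)).card +
          ((Finset.range 6).filter (fun t => (u * g2).coeff t ≠ 0)).card := by
  intro u hu
  obtain ⟨p0, p1, p2, p3, p4, p5⟩ := coeff_mul_palindromic_quintic u 8 5
  obtain ⟨q0, q1, q2, q3, q4, q5⟩ := coeff_mul_palindromic_quintic u 8 6
  rw [← hg1] at p0 p1 p2 p3 p4 p5
  rw [← hg2] at q0 q1 q2 q3 q4 q5
  rw [Finset.card_filter, Finset.card_filter, ← Finset.sum_add_distrib]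
  change 6 ≤ ∑ t ∈ Finset.range 6, pairWeight ((u * g1).coeff t) ((u * g2).coeff t)
  simp only [Finset.sum_range_succ, Finset.sum_range_zero, zero_add]
  by_contra! h
  rw [p0, p1, p2, p3, p4, p5, q0, q1, q2, q3, q4, q5] at h
  exact absurd (six_le_sum_pairWeight_of_partial_lt (u.coeff 0) hu (u.coeff 1) (by omega)
    (u.coeff 2) (by omega) (u.coeff 3) (by omega) (u.coeff 4) (by omega) (u.coeff 5)) (by omega)
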